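/- Let H be a complex Hilbert space, ν > 0, and let T be a bounded linear operator on H_{ν,0}(ℝ;H) such that T∂_{0,ν} ⊆ ∂_{0,ν}T, i.e. for every u ∈ dom(∂_{0,ν}) one has Tu ∈ dom(∂_{0,ν}) and ∂_{0,ν}Tu = T∂_{0,ν}u. Let ∂_{0,ν}T denote the operator with domain {u ∈ H_{ν,0}(ℝ;H) : Tu ∈ dom(∂_{0,ν})} acting as u ↦ ∂_{0,ν}(Tu). Then dom(∂_{0,ν}) is a core of ∂_{0,ν}T; more precisely, ∂_{0,ν}T equals the closure of the operator T∂_{0,ν} (the operator u ↦ T∂_{0,ν}u defined on dom(∂_{0,ν})), and the adjoint satisfies (∂_{0,ν}T)* = (∂_{0,ν})* T*. -/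

import Mathlib

open MeasureTheory
open scoped ContDiff

/-- The exponentially weighted Lebesgue measure `μ_ν = exp(−2νt) dt` on `ℝ`. -/
noncomputable def wMeasure (ν : ℝ) : Measure ℝ :=
  (volume : Measure ℝ).withDensity fun t => ENNReal.ofReal (Real.exp (-(2 * ν * t)))

variable (H : Type*) [NormedAddCommGroup H] [InnerProductSpace ℂ H] [CompleteSpace H]

/-- The graph of the derivative operator on smooth compactly supported functions,
viewed inside `H_{ν,0}(ℝ;H) × H_{ν,0}(ℝ;H)`. -/
noncomputable def testGraph (ν : ℝ) :
    Submodule ℂ (Lp H 2 (wMeasure ν) × Lp H 2 (wMeasure ν)) where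
  carrier := {p | ∃ φ : ℝ → H, ContDiff ℝ ∞ φ ∧ HasCompactSupport φ ∧
    (∀ᵐ t ∂(wMeasure ν), p.1 t = φ t) ∧ (∀ᵐ t ∂(wMeasure ν), p.2 t = deriv φ t)}
  add_mem' := by
    rintro ⟨f, f'⟩ ⟨g, g'⟩ ⟨φ, hφ1, hφ2, hφ3, hφ4⟩ ⟨ψ, hψ1, hψ2, hψ3, hψ4⟩
    refine ⟨φ + ψ, hφ1.add hψ1, hφ2.add hψ2, ?_, ?_⟩
    · filter_upwards [hφ3, hψ3, Lp.coeFn_add f g] with t h1 h2 h3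
      show (f + g : Lp H 2 (wMeasure ν)) t = φ t + ψ t
      rw [h3, Pi.add_apply, h1, h2]
    · filter_upwards [hφ4, hψ4, Lp.coeFn_add f' g'] with t h1 h2 h3
      show (f' + g' : Lp H 2 (wMeasure ν)) t = deriv (φ + ψ) t
      rw [h3, Pi.add_apply, h1, h2]
      exact (deriv_add ((hφ1.differentiable (by simp)).differentiableAt)
        ((hψ1.differentiable (by simp)).differentiableAt)).symm
  zero_mem' := by
    refine ⟨0, contDiff_zero_fun, by simp [hasCompactSupport_def], ?_, ?_⟩
    · filter_upwards [Lp.coeFn_zero H 2 (wMeasure ν)] with t h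
      show (0 : Lp H 2 (wMeasure ν)) t = (0 : ℝ → H) t
      simpa using h
    · filter_upwards [Lp.coeFn_zero H 2 (wMeasure ν)] with t h
      show (0 : Lp H 2 (wMeasure ν)) t = deriv (0 : ℝ → H) t
      have hd : deriv (0 : ℝ → H) t = 0 := by
        change deriv (fun _ => (0 : H)) t = 0
        simp
      rw [hd]
      simpa using h
  smul_mem' := by
    rintro a ⟨f, f'⟩ ⟨φ, hφ1, hφ2, hφ3, hφ4⟩
    refine ⟨a • φ, hφ1.const_smul a,
      hφ2.mono (Function.support_const_smul_subset a φ), ?_, ?_⟩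
    · filter_upwards [hφ3, Lp.coeFn_smul a f] with t h1 h2
      show (a • f : Lp H 2 (wMeasure ν)) t = (a • φ) t
      rw [h2, Pi.smul_apply, Pi.smul_apply, h1]
    · filter_upwards [hφ4, Lp.coeFn_smul a f'] with t h1 h2
      show (a • f' : Lp H 2 (wMeasure ν)) t = deriv (a • φ) t
      rw [h2, Pi.smul_apply, h1]
      exact (deriv_const_smul a ((hφ1.differentiable (by simp)).differentiableAt)).symm

/-- The time derivative `∂_{0,ν}`: the closure (of the graph) of the derivative operator
on smooth compactly supported functions in `H_{ν,0}(ℝ;H)`. -/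
noncomputable def timeDeriv (ν : ℝ) :
    Lp H 2 (wMeasure ν) →ₗ.[ℂ] Lp H 2 (wMeasure ν) :=
  ((testGraph H ν).topologicalClosure).toLinearPMap

/-- For a bounded operator `T` and a partially defined operator `S`, the operator
`S T : u ↦ S (T u)` with its natural domain `{u : T u ∈ dom S}`. -/
noncomputable def precompPMap {K : Type*} [NormedAddCommGroup K] [InnerProductSpace ℂ K]
    (T : K →L[ℂ] K) (S : K →ₗ.[ℂ] K) : K →ₗ.[ℂ] K where
  domain := S.domain.comap (T : K →ₗ[ℂ] K)
  toFun :=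
    { toFun := fun u => S ⟨T u.1, u.2⟩
      map_add' := by
        intro u v
        have h : (⟨T ((u + v : _) : K), (u + v).2⟩ : S.domain)
            = ⟨T u.1, u.2⟩ + ⟨T v.1, v.2⟩ := by ext; simp
        show S _ = S _ + S _
        rw [h]
        exact S.toFun.map_add _ _
      map_smul' := by
        intro a u
        have h : (⟨T ((a • u : _) : K), (a • u).2⟩ : S.domain)
            = a • (⟨T u.1, u.2⟩ : S.domain) := by ext; simp
        show S _ = a • S _
        rw [h]
        exact S.toFun.map_smul a _ }

/-- For a bounded operator `T` and a partially defined operator `S`, the operator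
`T S : u ↦ T (S u)` with domain `dom S`. -/
noncomputable def postcompPMap {K : Type*} [NormedAddCommGroup K] [InnerProductSpace ℂ K]
    (T : K →L[ℂ] K) (S : K →ₗ.[ℂ] K) : K →ₗ.[ℂ] K where
  domain := S.domain
  toFun := (T : K →ₗ[ℂ] K).comp S.toFun

section AbstractPart
open Topology
variable {K : Type*} [NormedAddCommGroup K] [InnerProductSpace ℂ K]

theorem acc_norm_le {G : Submodule ℂ (K × K)} (hacc : ∀ p ∈ G, 0 ≤ (inner ℂ p.1 p.2 : ℂ).re)
    {ε : ℝ} (hε : 0 < ε) {x y : K} (h : (x, y) ∈ G) : ‖x‖ ≤ ‖x + (ε : ℂ) • y‖ := by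
  have h1 := hacc _ h
  have h2 : ‖x + (ε : ℂ) • y‖ ^ 2 = ‖x‖ ^ 2 + 2 * (ε * (inner ℂ x y : ℂ).re)
      + ‖(ε : ℂ) • y‖ ^ 2 := by
    rw [@norm_add_sq ℂ, inner_smul_right]
    simp
  have h3 : 0 ≤ ε * (inner ℂ x y : ℂ).re := mul_nonneg hε.le h1
  have h4 : ‖x‖ ^ 2 ≤ ‖x + (ε : ℂ) • y‖ ^ 2 := by nlinarith [sq_nonneg ‖(ε : ℂ) • y‖]
  exact le_of_sq_le_sq h4 (norm_nonneg _)

theorem acc_surj [CompleteSpace K] {G : Submodule ℂ (K × K)}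
    (hcl : IsClosed (G : Set (K × K)))
    (hacc : ∀ p ∈ G, 0 ≤ (inner ℂ p.1 p.2 : ℂ).re)
    {ε : ℝ} (hε : 0 < ε) (hr : Dense {z : K | ∃ p ∈ G, p.1 + (ε : ℂ) • p.2 = z}) (z : K) :
    ∃ x y, (x, y) ∈ G ∧ x + (ε : ℂ) • y = z := by
  let L : (K × K) →L[ℂ] K :=
    ContinuousLinearMap.fst ℂ K K + (ε : ℂ) • ContinuousLinearMap.snd ℂ K K
  let f : G →L[ℂ] K := L.comp G.subtypeL
  have hf : ∀ p : G, f p = p.1.1 + (ε : ℂ) • p.1.2 := fun p => rfl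
  have : CompleteSpace G := hcl.completeSpace_coe
  have hanti : AntilipschitzWith (1 + 2 / ε).toNNReal f := by
    refine ContinuousLinearMap.antilipschitz_of_bound f fun p => ?_
    have h1 := acc_norm_le hacc hε (x := p.1.1) (y := p.1.2) p.2
    rw [← hf] at h1
    have hp : 0 ≤ 2 / ε := by positivity
    rw [Real.coe_toNNReal _ (by positivity)]
    have h2 : ε * ‖p.1.2‖ ≤ 2 * ‖f p‖ := by
      have : ε * ‖p.1.2‖ = ‖f p - p.1.1‖ := by
        rw [hf, add_sub_cancel_left, norm_smul]; simp [abs_of_pos hε]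
      rw [this]
      linarith [norm_sub_le (f p) p.1.1]
    have h3 : ‖p.1.2‖ ≤ 2 / ε * ‖f p‖ := by
      rw [div_mul_eq_mul_div, le_div_iff₀ hε]; linarith
    have h4 : 0 ≤ ‖f p‖ := norm_nonneg _
    change max ‖p.1.1‖ ‖p.1.2‖ ≤ _
    refine max_le ?_ ?_ <;> nlinarith [mul_nonneg hp h4]
  have hclr := hanti.isClosed_range f.uniformContinuous
  have : Set.range f = {z : K | ∃ p ∈ G, p.1 + (ε : ℂ) • p.2 = z} := by
    ext z; constructor
    · rintro ⟨p, rfl⟩; exact ⟨p.1, p.2, rfl⟩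
    · rintro ⟨p, hp, rfl⟩; exact ⟨⟨p, hp⟩, rfl⟩
  rw [this] at hclr
  have hz : z ∈ {z : K | ∃ p ∈ G, p.1 + (ε : ℂ) • p.2 = z} := by
    rw [← hclr.closure_eq]; exact hr z
  obtain ⟨p, hp, h⟩ := hz
  exact ⟨p.1, p.2, hp, h⟩

theorem acc_single {G : Submodule ℂ (K × K)}
    (hacc : ∀ p ∈ G, 0 ≤ (inner ℂ p.1 p.2 : ℂ).re)
    (hd : Dense {x : K | ∃ y, (x, y) ∈ G}) (p : K × K) (hp : p ∈ G) (h0 : p.1 = 0) :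
    p.2 = 0 := by
  obtain ⟨a, w⟩ := p
  simp only at h0
  subst h0
  have key : ∀ x ∈ {x : K | ∃ y, (x, y) ∈ G}, 0 ≤ (inner ℂ x w : ℂ).re := by
    rintro x ⟨y, hxy⟩
    have h1 : ∀ s : ℝ, 0 < s → 0 ≤ (inner ℂ x w : ℂ).re + s * (inner ℂ x y : ℂ).re := by
      intro s hs
      have h := hacc _ (G.add_mem (G.smul_mem (s : ℂ) hxy) hp)
      simp only [Prod.smul_mk, Prod.mk_add_mk, add_zero, inner_add_right, inner_smul_left,
        inner_smul_right, Complex.conj_ofReal, Complex.add_re, Complex.re_ofReal_mul] at h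
      have : 0 ≤ s * ((inner ℂ x w : ℂ).re + s * (inner ℂ x y : ℂ).re) := by linarith
      exact nonneg_of_mul_nonneg_right this hs
    by_contra hneg
    push Not at hneg
    set A := (inner ℂ x w : ℂ).re
    set B := (inner ℂ x y : ℂ).re
    have h2 := h1 (-A / (2 * (|B| + 1))) (div_pos (by linarith) (by positivity))
    have h3 : -A / (2 * (|B| + 1)) * B ≤ -A / 2 := by
      rw [div_mul_eq_mul_div, div_le_div_iff₀ (by positivity) (by norm_num)]
      nlinarith [le_abs_self B, abs_nonneg B]
    linarith
  have hall : ∀ x, 0 ≤ (inner ℂ x w : ℂ).re := by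
    intro x
    have hc : IsClosed {x : K | 0 ≤ (inner ℂ x w : ℂ).re} :=
      isClosed_le continuous_const (Complex.continuous_re.comp (by fun_prop))
    have := hd.closure_eq ▸ closure_minimal key hc
    exact this (Set.mem_univ x)
  have := hall (-w)
  rw [inner_neg_left, Complex.neg_re] at this
  have h5 : (inner ℂ w w : ℂ).re = ‖w‖ ^ 2 := by
    rw [inner_self_eq_norm_sq_to_K]; norm_cast
  rw [h5] at this
  have : ‖w‖ = 0 := by nlinarith [norm_nonneg w]
  simpa using this

theorem acc_approx {G : Submodule ℂ (K × K)}
    (hacc : ∀ p ∈ G, 0 ≤ (inner ℂ p.1 p.2 : ℂ).re)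
    (hd : Dense {x : K | ∃ y, (x, y) ∈ G}) (x : K) {δ : ℝ} (hδ : 0 < δ) :
    ∃ ε₀ > 0, ∀ ε : ℝ, 0 < ε → ε ≤ ε₀ → ∀ v y, (v, y) ∈ G → v + (ε : ℂ) • y = x →
      ‖v - x‖ < δ := by
  obtain ⟨a, hxa, ⟨b, hab⟩⟩ := Metric.dense_iff.1 hd x (δ / 3) (by positivity)
  rw [Metric.mem_ball, dist_eq_norm] at hxa
  refine ⟨δ / 3 / (‖b‖ + 1), by positivity, fun ε hε hle v y hvy hx => ?_⟩
  have h1 := acc_norm_le hacc hε (x := v - a) (y := y - b) (G.sub_mem hvy hab)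
  have h2 : v - a + (ε : ℂ) • (y - b) = - (a - x) - (ε : ℂ) • b := by
    rw [← hx, smul_sub]; abel
  have h3 : ‖(ε : ℂ) • b‖ = ε * ‖b‖ := by rw [norm_smul]; simp [abs_of_pos hε]
  have h4 : ε * ‖b‖ ≤ δ / 3 := by
    rw [le_div_iff₀ (by positivity)] at hle
    nlinarith [norm_nonneg b]
  have h5 := norm_sub_le (-(a - x)) ((ε : ℂ) • b)
  rw [norm_neg] at h5
  have h6 : ‖v - x‖ ≤ ‖v - a‖ + ‖a - x‖ := by
    have := norm_add_le (v - a) (a - x); rwa [sub_add_sub_cancel] at this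
  rw [h2] at h1
  linarith

theorem acc_core [CompleteSpace K] {G : Submodule ℂ (K × K)}
    (hcl : IsClosed (G : Set (K × K)))
    (hacc : ∀ p ∈ G, 0 ≤ (inner ℂ p.1 p.2 : ℂ).re)
    (hd : Dense {x : K | ∃ y, (x, y) ∈ G})
    (hr : ∀ ε : ℝ, 0 < ε → Dense {z : K | ∃ p ∈ G, p.1 + (ε : ℂ) • p.2 = z})
    (T : K →L[ℂ] K) (hT : ∀ x y, (x, y) ∈ G → (T x, T y) ∈ G)
    (u w : K) (hu : (T u, w) ∈ G) {δ : ℝ} (hδ : 0 < δ) :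
    ∃ v y, (v, y) ∈ G ∧ ‖v - u‖ < δ ∧ ‖T y - w‖ < δ := by
  obtain ⟨e1, he1, H1⟩ := acc_approx hacc hd u hδ
  obtain ⟨e2, he2, H2⟩ := acc_approx hacc hd w hδ
  set ε := min e1 e2
  have hε : 0 < ε := lt_min he1 he2
  have hε0 : (ε : ℂ) ≠ 0 := by exact_mod_cast hε.ne'
  obtain ⟨v, y, hvy, hv⟩ := acc_surj hcl hacc hε (hr ε hε) u
  obtain ⟨p, q, hpq, hp⟩ := acc_surj hcl hacc hε (hr ε hε) w
  have h1 := hT v y hvy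
  have hv' : T v + (ε : ℂ) • T y = T u := by rw [← hv]; simp
  have h2 : (T u - (ε : ℂ) • p, w - (ε : ℂ) • q) ∈ G := G.sub_mem hu (G.smul_mem (ε : ℂ) hpq)
  have h2' : w - (ε : ℂ) • q = p := by rw [← hp]; abel
  rw [h2'] at h2
  have h3 := acc_norm_le hacc hε (G.sub_mem h1 h2)
  have h4 : T v - (T u - (ε : ℂ) • p) + (ε : ℂ) • (T y - p) = 0 := by
    rw [← hv', smul_sub]; abel
  rw [h4, norm_zero] at h3
  have h5 : T v - (T u - (ε : ℂ) • p) = 0 := norm_le_zero_iff.1 h3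
  rw [h5, zero_add] at h4
  have h6 : T y = p := sub_eq_zero.1 ((smul_eq_zero.1 h4).resolve_left hε0)
  refine ⟨v, y, hvy, H1 ε hε (min_le_left _ _) v y hvy hv, ?_⟩
  rw [h6]
  exact H2 ε hε (min_le_right _ _) p q hpq hp

theorem mem_precomp_graph (T : K →L[ℂ] K) (S : K →ₗ.[ℂ] K) (u w : K) :
    (u, w) ∈ (precompPMap T S).graph ↔ (T u, w) ∈ S.graph := by
  rw [LinearPMap.mem_graph_iff, LinearPMap.mem_graph_iff]
  constructor
  · rintro ⟨y, h1, h2⟩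
    refine ⟨⟨T y.1, y.2⟩, ?_, h2⟩
    simp only at h1 ⊢
    rw [h1]
  · rintro ⟨y, h1, h2⟩
    simp only at h1 h2
    refine ⟨⟨u, show T u ∈ S.domain from h1 ▸ y.2⟩, rfl, ?_⟩
    rw [← h2]
    change S ⟨T u, _⟩ = S y
    congr 1
    exact Subtype.ext h1.symm

theorem mem_postcomp_graph (T : K →L[ℂ] K) (S : K →ₗ.[ℂ] K) (u w : K) :
    (u, w) ∈ (postcompPMap T S).graph ↔ ∃ y, (u, y) ∈ S.graph ∧ T y = w := by
  rw [LinearPMap.mem_graph_iff]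
  constructor
  · rintro ⟨y, h1, h2⟩
    refine ⟨S y, ?_, h2⟩
    rw [LinearPMap.mem_graph_iff]
    exact ⟨y, h1, rfl⟩
  · rintro ⟨y, h1, h2⟩
    rw [LinearPMap.mem_graph_iff] at h1
    obtain ⟨z, h3, h4⟩ := h1
    refine ⟨z, h3, ?_⟩
    rw [← h2]
    simp only at h4
    rw [← h4]
    rfl

theorem abstract_main [CompleteSpace K] (G : Submodule ℂ (K × K))
    (hcl : IsClosed (G : Set (K × K)))
    (hacc : ∀ p ∈ G, 0 ≤ (inner ℂ p.1 p.2 : ℂ).re)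
    (hd : Dense {x : K | ∃ y, (x, y) ∈ G})
    (hr : ∀ ε : ℝ, 0 < ε → Dense {z : K | ∃ p ∈ G, p.1 + (ε : ℂ) • p.2 = z})
    (T : K →L[ℂ] K) (D : K →ₗ.[ℂ] K) (hD : D = G.toLinearPMap)
    (hcomm : ∀ u (hu : u ∈ D.domain), ∃ hTu : T u ∈ D.domain, D ⟨T u, hTu⟩ = T (D ⟨u, hu⟩)) :
    ((precompPMap T D).domRestrict D.domain).closure = precompPMap T D ∧
    (postcompPMap T D).closure = precompPMap T D ∧
    (precompPMap T D).adjoint = precompPMap (ContinuousLinearMap.adjoint T) D.adjoint := by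
  have hG : D.graph = G := by
    rw [hD]
    exact Submodule.toLinearPMap_graph_eq _ (fun p hp h0 => acc_single hacc hd p hp h0)
  have hT : ∀ x y, (x, y) ∈ G → (T x, T y) ∈ G := by
    intro x y hxy
    rw [← hG, LinearPMap.mem_graph_iff] at hxy ⊢
    obtain ⟨z, h1, h2⟩ := hxy
    obtain ⟨h3, h4⟩ := hcomm z.1 z.2
    refine ⟨⟨T z.1, h3⟩, ?_, ?_⟩
    · simp only at h1 ⊢; rw [h1]
    · rw [h4]; simp only at h2 ⊢; rw [← h2]
  have hle : postcompPMap T D ≤ precompPMap T D := by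
    refine LinearPMap.le_of_le_graph ?_
    rintro ⟨u, w⟩ h
    rw [mem_postcomp_graph] at h
    obtain ⟨y, h1, rfl⟩ := h
    rw [mem_precomp_graph, hG]
    exact hT _ _ (hG ▸ h1)
  have hres : (precompPMap T D).domRestrict D.domain = postcompPMap T D := by
    refine LinearPMap.ext ?_ ?_
    · refine inf_eq_left.2 hle.1
    · intro x hx1 hx2
      refine (LinearPMap.domRestrict_le.2 (x := ⟨x, hx1⟩) (y := ⟨x, hle.1 hx2⟩) rfl).trans ?_
      exact (hle.2 (x := ⟨x, hx2⟩) (y := ⟨x, hle.1 hx2⟩) rfl).symm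
  have hclosed : (precompPMap T D).IsClosed := by
    have : ((precompPMap T D).graph : Set (K × K)) =
        (fun p : K × K => (T p.1, p.2)) ⁻¹' (G : Set (K × K)) := by
      ext ⟨u, w⟩
      simp only [SetLike.mem_coe, Set.mem_preimage]
      rw [mem_precomp_graph, hG]
    unfold LinearPMap.IsClosed
    rw [this]
    exact hcl.preimage (by fun_prop)
  have hclg : (postcompPMap T D).graph.topologicalClosure = (precompPMap T D).graph := by
    apply le_antisymm
    · exact Submodule.topologicalClosure_minimal _ (LinearPMap.le_graph_of_le hle) hclosed
    · rintro ⟨u, w⟩ h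
      rw [mem_precomp_graph, hG] at h
      change (u, w) ∈ closure ((postcompPMap T D).graph : Set (K × K))
      rw [Metric.mem_closure_iff]
      intro δ hδ
      obtain ⟨v, y, h1, h2, h3⟩ := acc_core hcl hacc hd hr T hT u w h hδ
      refine ⟨(v, T y), (mem_postcomp_graph _ _ _ _).2 ⟨y, hG ▸ h1, rfl⟩, ?_⟩
      rw [dist_comm, Prod.dist_eq]
      simp only [dist_eq_norm]
      exact max_lt h2 h3
  have hpost : (postcompPMap T D).closure = precompPMap T D := by
    apply LinearPMap.eq_of_eq_graph
    rw [← (hclosed.isClosable.leIsClosable hle).graph_closure_eq_closure_graph, hclg]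
  refine ⟨by rw [hres, hpost], hpost, ?_⟩
  have hdD : Dense (D.domain : Set K) := by
    refine hd.mono ?_
    rintro x ⟨y, hxy⟩
    rw [← hG] at hxy
    exact LinearPMap.mem_domain_of_mem_graph hxy
  have hdP : Dense ((precompPMap T D).domain : Set K) := hdD.mono hle.1
  apply LinearPMap.eq_of_eq_graph
  ext ⟨x, z⟩
  rw [mem_precomp_graph, LinearPMap.adjoint_graph_eq_graph_adjoint hdP,
    LinearPMap.adjoint_graph_eq_graph_adjoint hdD, Submodule.mem_adjoint_iff,
    Submodule.mem_adjoint_iff]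
  simp only [ContinuousLinearMap.adjoint_inner_right]
  constructor
  · intro h a b hab
    exact h a (T b) ((mem_precomp_graph _ _ _ _).2 (hG ▸ hT _ _ (hG ▸ hab)))
  · intro h a b hab
    have hc : IsClosed {p : K × K | inner ℂ p.2 x - inner ℂ p.1 z = 0} :=
      isClosed_eq (by fun_prop) continuous_const
    rw [← hclg] at hab
    refine closure_minimal ?_ hc hab
    rintro ⟨u, w⟩ huw
    obtain ⟨y, h1, rfl⟩ := (mem_postcomp_graph _ _ _ _).1 huw
    exact h u y h1

end AbstractPart

section ConcretePart
open Topology Filter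
variable {E : Type*} [NormedAddCommGroup E] [InnerProductSpace ℂ E] [CompleteSpace E]

theorem wMeasure_locFin (ν : ℝ) : IsLocallyFiniteMeasure (wMeasure ν) := by
  unfold wMeasure
  exact IsLocallyFiniteMeasure.withDensity_ofReal (by fun_prop)

theorem wMeasure_Icc_le {ν : ℝ} (hν : 0 < ν) {n : ℝ} (hn : 0 ≤ n) :
    wMeasure ν (Set.Icc n (n + 1)) ≤ 1 := by
  unfold wMeasure
  rw [withDensity_apply _ measurableSet_Icc]
  calc ∫⁻ t in Set.Icc n (n + 1), ENNReal.ofReal (Real.exp (-(2 * ν * t)))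
      ≤ ∫⁻ t in Set.Icc n (n + 1), 1 := by
        refine setLIntegral_mono' measurableSet_Icc fun t ht => ?_
        rw [ENNReal.ofReal_le_one, Real.exp_le_one_iff]
        have : 0 ≤ t := hn.trans ht.1
        have : 0 ≤ 2 * ν * t := by positivity
        linarith
    _ ≤ 1 := by simp

theorem test_acc {ν : ℝ} (hν : 0 < ν) (φ : ℝ → E) (h1 : ContDiff ℝ ∞ φ)
    (h2 : HasCompactSupport φ) :
    0 ≤ (∫ t, (inner ℂ (φ t) (deriv φ t) : ℂ) ∂(wMeasure ν)).re := by
  have hlf := wMeasure_locFin ν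
  have hcφ : Continuous φ := h1.continuous
  have hcd : Continuous (deriv φ) := h1.continuous_deriv (by simp)
  have hint : Integrable (fun t => (inner ℂ (φ t) (deriv φ t) : ℂ)) (wMeasure ν) := by
    refine Continuous.integrable_of_hasCompactSupport (by fun_prop) ?_
    refine h2.mono fun t ht => ?_
    simp only [Function.mem_support] at ht ⊢
    intro h; simp [h] at ht
  have e1 : (∫ t, (inner ℂ (φ t) (deriv φ t) : ℂ) ∂(wMeasure ν)).re
      = ∫ t, (inner ℂ (φ t) (deriv φ t) : ℂ).re ∂(wMeasure ν) := (integral_re hint).symm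
  rw [e1]
  have e2 : ∫ t, (inner ℂ (φ t) (deriv φ t) : ℂ).re ∂(wMeasure ν)
      = ∫ t, Real.exp (-(2 * ν * t)) * (inner ℂ (φ t) (deriv φ t) : ℂ).re := by
    unfold wMeasure
    rw [integral_withDensity_eq_integral_toReal_smul (by fun_prop) (by simp)]
    refine integral_congr_ae (Eventually.of_forall fun t => ?_)
    simp [ENNReal.toReal_ofReal (Real.exp_nonneg _)]
  rw [e2]
  have hder : ∀ t, HasDerivAt (fun t => Real.exp (-(2 * ν * t)) * ‖φ t‖ ^ 2)
      (2 * (Real.exp (-(2 * ν * t)) * (inner ℂ (φ t) (deriv φ t) : ℂ).re)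
        - 2 * ν * (Real.exp (-(2 * ν * t)) * ‖φ t‖ ^ 2)) t := by
    intro t
    have hφ : HasDerivAt φ (deriv φ t) t :=
      ((h1.differentiable (by simp)).differentiableAt).hasDerivAt
    have hn : HasDerivAt (fun t => ‖φ t‖ ^ 2) (2 * (inner ℂ (φ t) (deriv φ t) : ℂ).re) t := by
      letI : InnerProductSpace ℝ E := InnerProductSpace.rclikeToReal ℂ E
      have h := HasDerivAt.norm_sq (F := E) (f := φ) hφ
      exact h
    have he : HasDerivAt (fun t => Real.exp (-(2 * ν * t)))
        (Real.exp (-(2 * ν * t)) * (-(2 * ν))) t := by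
      refine HasDerivAt.exp ?_
      simpa using ((hasDerivAt_id t).const_mul (2 * ν)).fun_neg
    convert! he.mul hn using 1
    ring
  have i1 : Integrable (fun t => Real.exp (-(2 * ν * t)) * ‖φ t‖ ^ 2) := by
    refine Continuous.integrable_of_hasCompactSupport (by fun_prop) ?_
    refine h2.mono fun t ht => ?_
    simp only [Function.mem_support] at ht ⊢
    intro h; simp [h] at ht
  have i2 : Integrable
      (fun t => Real.exp (-(2 * ν * t)) * (inner ℂ (φ t) (deriv φ t) : ℂ).re) := by
    refine Continuous.integrable_of_hasCompactSupport ?_ ?_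
    · exact (by fun_prop : Continuous fun t => Real.exp (-(2 * ν * t))).mul
        (Complex.continuous_re.comp (by fun_prop))
    refine h2.mono fun t ht => ?_
    simp only [Function.mem_support] at ht ⊢
    intro h; simp [h] at ht
  have h0 := integral_eq_zero_of_hasDerivAt_of_integrable hder
    ((i2.const_mul 2).sub (i1.const_mul (2 * ν))) i1
  rw [integral_sub (i2.const_mul 2) (i1.const_mul (2 * ν)), integral_const_mul,
    integral_const_mul] at h0
  have h3 : 0 ≤ ∫ t, Real.exp (-(2 * ν * t)) * ‖φ t‖ ^ 2 :=
    integral_nonneg fun t => by positivity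
  nlinarith [mul_nonneg hν.le h3]

theorem testGraph_acc {ν : ℝ} (hν : 0 < ν) (p : Lp E 2 (wMeasure ν) × Lp E 2 (wMeasure ν))
    (hp : p ∈ testGraph E ν) : 0 ≤ (inner ℂ p.1 p.2 : ℂ).re := by
  obtain ⟨φ, h1, h2, h3, h4⟩ := hp
  rw [L2.inner_def]
  have : ∫ t, (inner ℂ (p.1 t) (p.2 t) : ℂ) ∂(wMeasure ν)
      = ∫ t, (inner ℂ (φ t) (deriv φ t) : ℂ) ∂(wMeasure ν) := by
    refine integral_congr_ae ?_
    filter_upwards [h3, h4] with t ht1 ht2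
    rw [ht1, ht2]
  rw [this]
  exact test_acc hν φ h1 h2

theorem deriv_smoothTransition_eq_zero {x : ℝ} (hx : x < 0 ∨ 1 < x) :
    deriv Real.smoothTransition x = 0 := by
  rcases hx with hx | hx
  · have : Real.smoothTransition =ᶠ[𝓝 x] fun _ => 0 := by
      filter_upwards [Iio_mem_nhds hx] with y hy
      exact Real.smoothTransition.zero_of_nonpos (le_of_lt hy)
    rw [this.deriv_eq]; simp
  · have : Real.smoothTransition =ᶠ[𝓝 x] fun _ => 1 := by
      filter_upwards [Ioi_mem_nhds hx] with y hy
      exact Real.smoothTransition.one_of_one_le (le_of_lt hy)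
    rw [this.deriv_eq]; simp

theorem exists_bound_deriv_smoothTransition :
    ∃ C : ℝ, 0 ≤ C ∧ ∀ x, |deriv Real.smoothTransition x| ≤ C := by
  have hc : Continuous (deriv Real.smoothTransition) :=
    (Real.smoothTransition.contDiff (n := 1)).continuous_deriv le_rfl
  obtain ⟨C, hC⟩ := (isCompact_Icc (a := (0 : ℝ)) (b := 1)).exists_bound_of_continuousOn
    hc.continuousOn
  refine ⟨max C 0, le_max_right _ _, fun x => ?_⟩
  by_cases hx : x ∈ Set.Icc (0 : ℝ) 1
  · exact (hC x hx).trans (le_max_left _ _)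
  · rw [deriv_smoothTransition_eq_zero, abs_zero]
    · exact le_max_right _ _
    · by_contra h
      push Not at h
      exact hx ⟨h.1, h.2⟩

theorem test_range {ν : ℝ} (hν : 0 < ν) {ε : ℝ} (hε : 0 < ε) (g : ℝ → E)
    (hg : ContDiff ℝ ∞ g) (hgs : HasCompactSupport g) {δ : ℝ} (hδ : 0 < δ) :
    ∃ φ : ℝ → E, ContDiff ℝ ∞ φ ∧ HasCompactSupport φ ∧
      eLpNorm (fun t => φ t + ε • deriv φ t - g t) 2 (wMeasure ν) ≤ ENNReal.ofReal δ := by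
  obtain ⟨a, ha0, ha⟩ : ∃ a : ℝ, 0 ≤ a ∧ ∀ t, a < |t| → g t = 0 := by
    obtain ⟨r, hr⟩ := hgs.isCompact.isBounded.subset_closedBall 0
    refine ⟨max r 0, le_max_right _ _, fun t ht => ?_⟩
    by_contra h
    have := hr (subset_tsupport g h)
    rw [mem_closedBall_zero_iff, Real.norm_eq_abs] at this
    exact absurd (this.trans (le_max_left r 0)) (not_le.2 ht)
  set k : ℝ → E := fun s => (ε⁻¹ * Real.exp (s / ε)) • g s with hk
  have hks : ContDiff ℝ ∞ k := by
    have hsc : ContDiff ℝ ∞ (fun s : ℝ => ε⁻¹ * Real.exp (s / ε)) :=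
      contDiff_const.mul (Real.contDiff_exp.comp (contDiff_id.div_const _))
    exact hsc.smul hg
  set F : ℝ → E := fun t => ∫ s in (-a)..t, k s with hF
  have hFd : ∀ t, HasDerivAt F (k t) t := fun t =>
    (hks.continuous.integral_hasStrictDerivAt (-a) t).hasDerivAt
  have hFs : ContDiff ℝ ∞ F := by
    rw [contDiff_infty_iff_deriv]
    refine ⟨fun t => (hFd t).differentiableAt, ?_⟩
    rw [show deriv F = k from funext fun t => (hFd t).deriv]
    exact hks
  have hFl : ∀ t, t ≤ -a → F t = 0 := by
    intro t ht
    change ∫ s in (-a)..t, k s = 0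
    rw [intervalIntegral.integral_symm, intervalIntegral.integral_of_le ht,
      integral_Ioc_eq_integral_Ioo, neg_eq_zero]
    refine setIntegral_eq_zero_of_forall_eq_zero fun s hs => ?_
    have hs2 := hs.2
    simp only [hk]
    rw [ha s (by rw [abs_of_neg (by linarith)]; linarith), smul_zero]
  have hFr : ∀ t, a ≤ t → F t = F a := by
    intro t ht
    have : F t - F a = ∫ s in a..t, k s :=
      intervalIntegral.integral_interval_sub_left (hks.continuous.intervalIntegrable _ _)
        (hks.continuous.intervalIntegrable _ _)
    rw [← sub_eq_zero, this, intervalIntegral.integral_of_le ht]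
    refine setIntegral_eq_zero_of_forall_eq_zero fun s hs => ?_
    have hs1 := hs.1
    simp only [hk]
    rw [ha s (by rw [abs_of_pos (by linarith)]; linarith), smul_zero]
  obtain ⟨C, hC0, hC⟩ := exists_bound_deriv_smoothTransition
  have hlim : Tendsto (fun n : ℝ => ε * C * ‖F a‖ * Real.exp (-n / ε)) atTop (𝓝 0) := by
    have h1 : Tendsto (fun n : ℝ => n / ε) atTop atTop := tendsto_id.atTop_div_const hε
    have h2 := (Real.tendsto_exp_neg_atTop_nhds_zero.comp h1).const_mul (ε * C * ‖F a‖)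
    rw [mul_zero] at h2
    refine h2.congr fun n => ?_
    simp [neg_div]
  obtain ⟨n, hn1, hn2⟩ := ((hlim.eventually (gt_mem_nhds hδ)).and
    (eventually_gt_atTop a)).exists
  have hn0 : 0 ≤ n := by linarith
  set χ : ℝ → ℝ := fun t => Real.smoothTransition (n + 1 - t) with hχ
  have hχs : ContDiff ℝ ∞ χ :=
    Real.smoothTransition.contDiff.comp (contDiff_const.sub contDiff_id)
  have hχd : ∀ t, HasDerivAt χ (-deriv Real.smoothTransition (n + 1 - t)) t := by
    intro t
    have h1 : HasDerivAt Real.smoothTransition (deriv Real.smoothTransition (n + 1 - t))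
        (n + 1 - t) :=
      ((Real.smoothTransition.contDiff (n := 1)).differentiable (by simp)).differentiableAt.hasDerivAt
    have h2 := h1.comp_const_sub (n + 1) t
    exact h2
  set ex : ℝ → ℝ := fun t => Real.exp (-t / ε) with hex
  have hexs : ContDiff ℝ ∞ ex := Real.contDiff_exp.comp (contDiff_id.neg.div_const _)
  have hexd : ∀ t, HasDerivAt ex (ex t * (-1 / ε)) t := by
    intro t
    exact ((hasDerivAt_id t).neg.div_const ε).exp
  have hφd : ∀ t, HasDerivAt (fun t => (χ t * ex t) • F t)
      ((χ t * ex t) • k t +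
        (-deriv Real.smoothTransition (n + 1 - t) * ex t + χ t * (ex t * (-1 / ε))) • F t) t :=
    fun t => ((hχd t).mul (hexd t)).smul (hFd t)
  refine ⟨fun t => (χ t * ex t) • F t, (hχs.mul hexs).smul hFs, ?_, ?_⟩
  · refine HasCompactSupport.of_support_subset_isCompact
      (isCompact_Icc (a := -a) (b := n + 1)) fun t ht => ?_
    by_contra hc
    apply ht
    simp only [Set.mem_Icc, not_and_or, not_le] at hc
    rcases hc with hc | hc
    · simp only [hFl t hc.le, smul_zero]
    · have : χ t = 0 := Real.smoothTransition.zero_of_nonpos (by linarith)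
      simp [this]
  · have herr : ∀ t, (χ t * ex t) • F t + ε • deriv (fun t => (χ t * ex t) • F t) t - g t
        = (-(ε * deriv Real.smoothTransition (n + 1 - t) * ex t)) • F t
          + (χ t - 1) • g t := by
      intro t
      rw [(hφd t).deriv]
      have h1 : ε • (χ t * ex t) • k t = χ t • g t := by
        simp only [hk, hex, smul_smul]
        congr 1
        rw [neg_div, Real.exp_neg]
        field_simp
      rw [smul_add, h1, smul_smul, sub_smul, one_smul]
      have h2 : ε * (-deriv Real.smoothTransition (n + 1 - t) * ex t + χ t * (ex t * (-1 / ε)))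
        = -(ε * deriv Real.smoothTransition (n + 1 - t) * ex t) - χ t * ex t := by
        field_simp
        ring
      rw [h2, sub_smul]
      abel
    simp only [herr]
    have hlt : ∀ t, t < n → χ t = 1 := fun t ht =>
      Real.smoothTransition.one_of_one_le (by linarith)
    have hb : ∀ t, ‖(-(ε * deriv Real.smoothTransition (n + 1 - t) * ex t)) • F t
          + (χ t - 1) • g t‖ ≤ (Set.Icc n (n + 1)).indicator (fun _ => δ) t := by
      intro t
      by_cases ht : t ∈ Set.Icc n (n + 1)
      · rw [Set.indicator_of_mem ht, ha t (by rw [abs_of_nonneg (by linarith [ht.1])]; linarith [ht.1]),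
          smul_zero, add_zero, hFr t (by linarith [ht.1]), norm_smul, norm_neg, norm_mul, norm_mul,
          Real.norm_eq_abs, Real.norm_eq_abs, Real.norm_eq_abs, abs_of_pos hε,
          abs_of_pos (Real.exp_pos _)]
        have h1 : ex t ≤ Real.exp (-n / ε) := by
          simp only [hex]
          gcongr
          exact ht.1
        calc ε * |deriv Real.smoothTransition (n + 1 - t)| * ex t * ‖F a‖
            ≤ ε * C * Real.exp (-n / ε) * ‖F a‖ := by
              have := hC (n + 1 - t)
              gcongr
          _ = ε * C * ‖F a‖ * Real.exp (-n / ε) := by ring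
          _ ≤ δ := hn1.le
      · rw [Set.indicator_of_notMem ht]
        simp only [Set.mem_Icc, not_and_or, not_le] at ht
        rcases ht with ht | ht
        · rw [deriv_smoothTransition_eq_zero (Or.inr (by linarith)), hlt t ht]
          simp
        · rw [deriv_smoothTransition_eq_zero (Or.inl (by linarith)),
            ha t (by rw [abs_of_nonneg (by linarith)]; linarith)]
          simp
    calc _ ≤ eLpNorm ((Set.Icc n (n + 1)).indicator (fun _ => δ)) 2 (wMeasure ν) :=
          eLpNorm_mono_real hb
      _ ≤ ‖δ‖ₑ * wMeasure ν (Set.Icc n (n + 1)) ^ (1 / (2 : ENNReal).toReal) :=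
          eLpNorm_indicator_const_le _ _
      _ ≤ ‖δ‖ₑ * 1 := by
          gcongr
          exact ENNReal.rpow_le_one (wMeasure_Icc_le hν hn0) (by simp)
      _ = ENNReal.ofReal δ := by rw [mul_one, Real.enorm_eq_ofReal hδ.le]

theorem testGraph_mem {ν : ℝ} (φ : ℝ → E) (h1 : ContDiff ℝ ∞ φ) (h2 : HasCompactSupport φ) :
    ∃ p ∈ testGraph E ν, p.1 =ᵐ[wMeasure ν] φ ∧ p.2 =ᵐ[wMeasure ν] deriv φ := by
  have hlf := wMeasure_locFin ν
  have m1 : MemLp φ 2 (wMeasure ν) := h1.continuous.memLp_of_hasCompactSupport h2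
  have m2 : MemLp (deriv φ) 2 (wMeasure ν) :=
    (h1.continuous_deriv (by simp)).memLp_of_hasCompactSupport h2.deriv
  exact ⟨(m1.toLp, m2.toLp), ⟨φ, h1, h2, m1.coeFn_toLp, m2.coeFn_toLp⟩,
    m1.coeFn_toLp, m2.coeFn_toLp⟩

theorem testGraph_dense (ν : ℝ) :
    Dense {x : Lp E 2 (wMeasure ν) | ∃ y, (x, y) ∈ (testGraph E ν).topologicalClosure} := by
  have hlf := wMeasure_locFin ν
  refine (Lp.dense_hasCompactSupport_contDiff (F := E) (μ := wMeasure ν) (p := 2)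
    (by simp)).mono ?_
  rintro f ⟨g, h1, h2, h3⟩
  obtain ⟨p, hp, e1, e2⟩ := testGraph_mem (ν := ν) g h3 h2
  have : f = p.1 := Lp.ext (h1.trans e1.symm)
  exact ⟨p.2, Submodule.le_topologicalClosure _ (by rw [this]; exact hp)⟩

theorem testGraph_range {ν : ℝ} (hν : 0 < ν) {ε : ℝ} (hε : 0 < ε) :
    Dense {z : Lp E 2 (wMeasure ν) |
      ∃ p ∈ (testGraph E ν).topologicalClosure, p.1 + (ε : ℂ) • p.2 = z} := by
  have hlf := wMeasure_locFin ν
  rw [← dense_closure]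
  refine (Lp.dense_hasCompactSupport_contDiff (F := E) (μ := wMeasure ν) (p := 2)
    (by simp)).mono ?_
  rintro f ⟨g, h1, h2, h3⟩
  rw [Metric.mem_closure_iff]
  intro δ hδ
  obtain ⟨φ, hφ1, hφ2, hφ3⟩ := test_range hν hε g h3 h2 (half_pos hδ)
  obtain ⟨p, hp, e1, e2⟩ := testGraph_mem (ν := ν) φ hφ1 hφ2
  refine ⟨_, ⟨p, Submodule.le_topologicalClosure _ hp, rfl⟩, ?_⟩
  rw [dist_comm, dist_eq_norm, Lp.norm_def]
  have : eLpNorm (p.1 + (ε : ℂ) • p.2 - f : Lp E 2 (wMeasure ν)) 2 (wMeasure ν)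
      = eLpNorm (fun t => φ t + ε • deriv φ t - g t) 2 (wMeasure ν) := by
    refine eLpNorm_congr_ae ?_
    filter_upwards [h1, e1, e2, Lp.coeFn_sub (p.1 + (ε : ℂ) • p.2) f,
      Lp.coeFn_add p.1 ((ε : ℂ) • p.2), Lp.coeFn_smul (ε : ℂ) p.2] with t a1 a2 a3 a4 a5 a6
    rw [a4, Pi.sub_apply, a5, Pi.add_apply, a6, Pi.smul_apply, a1, a2, a3, Complex.coe_smul]
  rw [this]
  calc _ ≤ (ENNReal.ofReal (δ / 2)).toReal := ENNReal.toReal_mono ENNReal.ofReal_ne_top hφ3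
    _ = δ / 2 := ENNReal.toReal_ofReal (by positivity)
    _ < δ := by linarith

theorem testGraph_closure_acc {ν : ℝ} (hν : 0 < ν)
    (p : Lp E 2 (wMeasure ν) × Lp E 2 (wMeasure ν))
    (hp : p ∈ (testGraph E ν).topologicalClosure) : 0 ≤ (inner ℂ p.1 p.2 : ℂ).re := by
  have hc : IsClosed {p : Lp E 2 (wMeasure ν) × Lp E 2 (wMeasure ν) |
      0 ≤ (inner ℂ p.1 p.2 : ℂ).re} :=
    isClosed_le continuous_const (Complex.continuous_re.comp (by fun_prop))
  exact closure_minimal (fun q hq => testGraph_acc hν q hq) hc hp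

end ConcretePart

/-- If `T` is a bounded linear operator on `H_{ν,0}(ℝ;H)` with
`T ∂_{0,ν} ⊆ ∂_{0,ν} T`, then `dom ∂_{0,ν}` is a core of `∂_{0,ν} T`; more precisely
`∂_{0,ν} T` is the closure of `T ∂_{0,ν}`, and `(∂_{0,ν} T)* = (∂_{0,ν})* T*`. -/
theorem timeDeriv_comp_core_and_adjoint
    (ν : ℝ) (hν : 0 < ν)
    (T : Lp H 2 (wMeasure ν) →L[ℂ] Lp H 2 (wMeasure ν))
    (hcomm : ∀ u (hu : u ∈ (timeDeriv H ν).domain),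
      ∃ hTu : T u ∈ (timeDeriv H ν).domain,
        timeDeriv H ν ⟨T u, hTu⟩ = T (timeDeriv H ν ⟨u, hu⟩)) :
    ((precompPMap T (timeDeriv H ν)).domRestrict (timeDeriv H ν).domain).closure
        = precompPMap T (timeDeriv H ν) ∧
    (postcompPMap T (timeDeriv H ν)).closure = precompPMap T (timeDeriv H ν) ∧
    (precompPMap T (timeDeriv H ν)).adjoint
        = precompPMap (ContinuousLinearMap.adjoint T) (timeDeriv H ν).adjoint := by

  exact abstract_main (testGraph H ν).topologicalClosure
    (Submodule.isClosed_topologicalClosure _)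
    (testGraph_closure_acc hν) (testGraph_dense ν) (fun _ hε => testGraph_range hν hε)
    T (timeDeriv H ν) rfl hcomm
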